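/- For every positive integer n and every k with 1 ≤ k ≤ 2n−1, the number of binary paths P ∈ 𝒫_n having degree δ(P) = k equals the binomial coefficient C(min{n,k}, ⌊(k+2)/2⌋). -/

import Mathlib

/-- A binary path is a list of steps: `true` = upstep `u`, `false` = downstep `d`. -/
abbrev BinPath := List Bool

/-- `ht P k` is the height of the `k`-th point of the path `P` (the point reached
after the first `k` steps). -/
def ht (P : BinPath) (k : ℕ) : ℤ :=
  ((P.take k).map (fun b => if b then (1 : ℤ) else -1)).sum

/-- The lattice order on binary paths of the same length: `P ≤ Q` iff
`hᵢ(P) ≤ hᵢ(Q)` for all `i`. -/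
def pathLe (P Q : BinPath) : Prop :=
  P.length = Q.length ∧ ∀ k, ht P k ≤ ht Q k

def pathLt (P Q : BinPath) : Prop := pathLe P Q ∧ P ≠ Q

/-- The maximum path `1ₙ = uⁿ`. -/
def maxPath (n : ℕ) : BinPath := List.replicate n true

/-- Step `i` (0-based) of `P` is a downstep whose endpoint is a valley, i.e. it is
followed by an upstep or it is the last step of `P`. -/
def isValley (P : BinPath) (i : ℕ) : Prop :=
  i < P.length ∧ P.getD i true = false ∧ P.getD (i + 1) true = true

/-- The number of valleys of `P`. -/
def numValleys (P : BinPath) : ℕ :=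
  ((Finset.range P.length).filter
    (fun i => P.getD i true = false ∧ P.getD (i + 1) true = true)).card

/-- The filling of `P`: every valley of `P` is turned into a peak
(each occurrence `du` whose middle point is a valley becomes `ud`, and a final
valley-`d` becomes `u`). -/
def fill (P : BinPath) : BinPath :=
  List.ofFn (fun i : Fin P.length =>
    if P.get i then P.getD (i.1 - 1) true else P.getD (i.1 + 1) true)

/-- The degree of `P`: the least `k` such that the `k`-fold iterated filling
of `P` is the maximum path. -/
noncomputable def degree (P : BinPath) : ℕ :=
  sInf {k | fill^[k] P = maxPath P.length}

/-- `fPath P` is the number of chains from `P` to the maximum path `1_{|P|}` of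
length `degree P` having small intervals. -/
noncomputable def fPath (P : BinPath) : ℕ :=
  Set.ncard {c : ℕ → BinPath |
    c 0 = P ∧ (∀ i, degree P ≤ i → c i = maxPath P.length) ∧
    ∀ i < degree P, pathLt (c i) (c (i + 1)) ∧ pathLe (c (i + 1)) (fill (c i))}

/-- Height of the lowest valley of `P`. -/
noncomputable def lv (P : BinPath) : ℤ :=
  sInf {h : ℤ | ∃ i, isValley P i ∧ ht P (i + 1) = h}

/-- Height of the highest valley of `P`. -/
noncomputable def hv (P : BinPath) : ℤ :=
  sSup {h : ℤ | ∃ i, isValley P i ∧ ht P (i + 1) = h}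

noncomputable def hvNat (P : BinPath) : ℕ := (hv P).toNat

/-- `P′`: every low valley of `P` is turned into a peak. -/
noncomputable def lowFill (P : BinPath) : BinPath :=
  List.ofFn (fun i : Fin P.length =>
    if P.get i then
      (if P.getD (i.1 - 1) true = false ∧ ht P i.1 = lv P then false else true)
    else
      (if P.getD (i.1 + 1) true = true ∧ ht P (i.1 + 1) = lv P then true else false))

/-- `P*`: every valley of `P` is turned into a peak, except the last one when `P`
ends with a downstep. -/
def starFill (P : BinPath) : BinPath :=
  List.ofFn (fun i : Fin P.length =>
    if i.1 + 1 = P.length ∧ P.get i = false then false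
    else if P.get i then P.getD (i.1 - 1) true else P.getD (i.1 + 1) true)

/-- A Dyck path: starts and ends at height 0 and lies weakly above height 0. -/
def IsDyck (P : BinPath) : Prop := ht P P.length = 0 ∧ ∀ k, 0 ≤ ht P k

/-- A Dyck prefix: a prefix of a Dyck path. -/
def IsDyckPrefix (P : BinPath) : Prop := ∃ Q : BinPath, IsDyck (P ++ Q)

/-- A Dyck suffix: a suffix of a Dyck path. -/
def IsDyckSuffix (P : BinPath) : Prop := ∃ Q : BinPath, IsDyck (Q ++ P)

/-- The pyramid `u^m d^m`. -/
def pyramid (m : ℕ) : BinPath := List.replicate m true ++ List.replicate m false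

/-- Cardinality of the interval `[P, Q]` in the lattice of binary paths. -/
noncomputable def intervalCard (P Q : BinPath) : ℕ :=
  Set.ncard {R : BinPath | pathLe P R ∧ pathLe R Q}

/-- `I(s) = |[s, u^{|s|/2} d^{|s|/2}]|`. -/
noncomputable def Ifun (s : BinPath) : ℕ := intervalCard s (pyramid (s.length / 2))

/-- `J(P) = |[P, u^{|P|}]|`. -/
noncomputable def Jfun (P : BinPath) : ℕ := intervalCard P (maxPath P.length)

/-- `P` and `Q` have exactly the same valleys at every height at most `m`. -/
def sameValleysUpTo (P Q : BinPath) (m : ℤ) : Prop :=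
  ∀ (i : ℕ) (t : ℤ), t ≤ m →
    ((isValley P i ∧ ht P (i + 1) = t) ↔ (isValley Q i ∧ ht Q (i + 1) = t))

/-- A multichain of Dyck paths of type `V` from `a` to `s`: it has length
`h = hv(a)` and for every `j ∈ [h]` its `(j-1)`-st and `j`-th members have the
same valleys at every height at most `h - j`.  (The function `σ` is frozen from
index `h` on, so that such multichains are counted correctly.) -/
def IsVChain (a s : BinPath) (σ : ℕ → BinPath) : Prop :=
  σ 0 = a ∧ (∀ j, hvNat a ≤ j → σ j = s) ∧ (∀ j, IsDyck (σ j)) ∧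
  (∀ j < hvNat a, pathLe (σ j) (σ (j + 1))) ∧
  (∀ j, 1 ≤ j → j ≤ hvNat a →
    sameValleysUpTo (σ (j - 1)) (σ j) ((hvNat a : ℤ) - (j : ℤ)))

/-- `V(a,s)`: the number of `a`–`s` multichains of type `V`. -/
noncomputable def VPath (a s : BinPath) : ℕ :=
  Set.ncard {σ : ℕ → BinPath | IsVChain a s σ}

/-- `ζ^k(P,Q)`: the number of `P`–`Q` multichains of length `k`. -/
noncomputable def zetaPow (k : ℕ) (P Q : BinPath) : ℕ :=
  Set.ncard {c : ℕ → BinPath |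
    c 0 = P ∧ (∀ i, k ≤ i → c i = Q) ∧ ∀ i < k, pathLe (c i) (c (i + 1))}

/-- The join of two paths of the same length (pointwise max of heights). -/
def pathSup (P Q : BinPath) : BinPath :=
  List.ofFn (fun i : Fin P.length =>
    decide (max (ht P i.1) (ht Q i.1) < max (ht P (i.1 + 1)) (ht Q (i.1 + 1))))

/-- The meet of two paths of the same length (pointwise min of heights). -/
def pathInf (P Q : BinPath) : BinPath :=
  List.ofFn (fun i : Fin P.length =>
    decide (min (ht P i.1) (ht Q i.1) < min (ht P (i.1 + 1)) (ht Q (i.1 + 1))))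

/-- `Q` covers `P` in the lattice of binary paths. -/
def pathCovBy (P Q : BinPath) : Prop :=
  pathLt P Q ∧ ∀ R : BinPath, pathLt P R → pathLt R Q → False

/-- `l(P,Q) = (1/2)·Σᵢ (hᵢ(Q) − hᵢ(P))`. -/
def lpq (P Q : BinPath) : ℕ :=
  ((∑ i ∈ Finset.range P.length, (ht Q (i + 1) - ht P (i + 1))) / 2).toNat

/-- Convolution in the incidence algebra of the lattice of binary paths. -/
noncomputable def conv (F G : BinPath → BinPath → ℤ) : BinPath → BinPath → ℤ :=
  fun P Q => ∑ᶠ (R : BinPath) (_ : pathLe P R ∧ pathLe R Q), F P R * G R Q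

/-- The delta function of the incidence algebra. -/
def deltaFun : BinPath → BinPath → ℤ := fun P Q => if P = Q then 1 else 0

/-- `μ^k`: the `k`-th convolution power of `μ` (`μ^0` is the delta function). -/
noncomputable def muPow (mu : BinPath → BinPath → ℤ) (k : ℕ) : BinPath → BinPath → ℤ :=
  (conv mu)^[k] deltaFun

@[simp]
theorem length_fill (P : BinPath) : (fill P).length = P.length := by
  simp [fill]

theorem getD_fill (P : BinPath) (i : ℕ) : (fill P).getD i true =
    if P.getD i true then (if i < P.length then P.getD (i - 1) true else true)
    else P.getD (i + 1) true := by
  by_cases h : i < P.length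
  · simp [fill, List.getD, h]
  · simp [fill, List.getD, h]

theorem eq_of_getD {P Q : BinPath} (hl : P.length = Q.length)
    (h : ∀ i, P.getD i true = Q.getD i true) : P = Q := by
  refine List.ext_getElem hl fun i h1 h2 => ?_
  simpa [List.getD, h1, h2] using h i

theorem fill_true_cons (P : BinPath) : fill (true :: P) = true :: fill P := by
  refine eq_of_getD (by simp) fun i => ?_
  rcases i with _ | _ | i <;>
    simp only [List.getD_cons_zero, List.getD_cons_succ, getD_fill]
  · simp
  · rcases P with _ | ⟨_ | _, P⟩ <;> simp
  · simp

theorem fill_false_true_cons (P : BinPath) :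
    fill (false :: true :: P) = true :: false :: fill P := by
  refine eq_of_getD (by simp) fun i => ?_
  rcases i with _ | _ | _ | i <;>
    simp only [List.getD_cons_zero, List.getD_cons_succ, getD_fill]
  · simp
  · simp
  · rcases P with _ | ⟨_ | _, P⟩ <;> simp
  · simp

theorem fill_false_false_cons (P : BinPath) :
    fill (false :: false :: P) = false :: fill (false :: P) := by
  refine eq_of_getD (by simp) fun i => ?_
  rcases i with _ | _ | i <;>
    simp only [List.getD_cons_zero, List.getD_cons_succ, getD_fill] <;>
    simp

/-- A recursive formula for the degree: each downstep travels to the right end of the path,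
and leaves it at least two fillings after the next downstep on its right. -/
def recDegree : BinPath → ℕ
  | [] => 0
  | true :: P => recDegree P
  | [false] => 1
  | false :: P => max (P.length + 1) (recDegree P + 2)

theorem recDegree_true_cons (P : BinPath) : recDegree (true :: P) = recDegree P := by
  simp [recDegree]

theorem recDegree_false_cons {P : BinPath} (h : 0 < P.length) :
    recDegree (false :: P) = max (P.length + 1) (recDegree P + 2) := by
  rcases P with _ | ⟨b, P⟩
  · simp at h
  · simp [recDegree]

theorem length_lt_recDegree_false_cons (P : BinPath) :
    P.length + 1 ≤ recDegree (false :: P) := by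
  rcases P with _ | ⟨b, P⟩
  · simp [recDegree]
  · simp [recDegree]

theorem recDegree_eq_zero_iff (P : BinPath) : recDegree P = 0 ↔ P = maxPath P.length := by
  induction P with
  | nil => simp [recDegree, maxPath]
  | cons b P ih =>
    cases b with
    | true =>
      rw [recDegree_true_cons, ih]
      simp [maxPath, List.replicate_succ]
    | false =>
      have := length_lt_recDegree_false_cons P
      simp only [maxPath, List.length_cons, List.replicate_succ, List.cons.injEq,
        Bool.false_eq_true, false_and, iff_false]
      omega

theorem recDegree_fill : ∀ P : BinPath, recDegree (fill P) = recDegree P - 1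
  | [] => rfl
  | true :: P => by
    rw [fill_true_cons, recDegree_true_cons, recDegree_true_cons, recDegree_fill P]
  | [false] => rfl
  | false :: true :: P => by
    have ih := recDegree_fill P
    rw [fill_false_true_cons, recDegree_true_cons, recDegree_false_cons (P := true :: P) (by simp),
      recDegree_true_cons]
    rcases P with _ | ⟨b, P⟩
    · rfl
    · rw [recDegree_false_cons (by simp), ih]
      simp only [length_fill, List.length_cons]
      omega
  | false :: false :: P => by
    have ih := recDegree_fill (false :: P)
    have := length_lt_recDegree_false_cons P
    rw [fill_false_false_cons, recDegree_false_cons (by simp), ih,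
      recDegree_false_cons (P := false :: P) (by simp)]
    simp only [length_fill, List.length_cons]
    omega

theorem length_fill_iterate (P : BinPath) (k : ℕ) : (fill^[k] P).length = P.length := by
  induction k with
  | zero => rfl
  | succ k ih => rw [Function.iterate_succ_apply', length_fill, ih]

theorem recDegree_fill_iterate (P : BinPath) (k : ℕ) :
    recDegree (fill^[k] P) = recDegree P - k := by
  induction k with
  | zero => rfl
  | succ k ih => rw [Function.iterate_succ_apply', recDegree_fill, ih, Nat.sub_sub]

theorem degree_eq_recDegree (P : BinPath) : degree P = recDegree P := by
  have h : {k | fill^[k] P = maxPath P.length} = Set.Ici (recDegree P) := by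
    ext k
    have := recDegree_eq_zero_iff (fill^[k] P)
    rw [length_fill_iterate, recDegree_fill_iterate] at this
    rw [Set.mem_ofPred_eq, ← this, Set.mem_Ici, Nat.sub_eq_zero_iff_le]
  rw [degree, h, csInf_Ici]

theorem finite_setOf_length_eq_and (n : ℕ) (p : BinPath → Prop) :
    {P : BinPath | P.length = n ∧ p P}.Finite :=
  (List.finite_length_eq Bool n).subset fun _ h => h.1

theorem ncard_length_succ (n : ℕ) (p : BinPath → Prop) :
    {P : BinPath | P.length = n + 1 ∧ p P}.ncard =
      {P : BinPath | P.length = n ∧ p (true :: P)}.ncard +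
        {P : BinPath | P.length = n ∧ p (false :: P)}.ncard := by
  have h : {P : BinPath | P.length = n + 1 ∧ p P} =
      List.cons true '' {P : BinPath | P.length = n ∧ p (true :: P)} ∪
        List.cons false '' {P : BinPath | P.length = n ∧ p (false :: P)} := by
    ext P
    rcases P with _ | ⟨_ | _, P⟩ <;> simp
  rw [h, Set.ncard_union_eq _ ((finite_setOf_length_eq_and _ _).image _)
      ((finite_setOf_length_eq_and _ _).image _),
    Set.ncard_image_of_injective _ List.cons_injective,
    Set.ncard_image_of_injective _ List.cons_injective]
  rw [Set.disjoint_left]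
  rintro _ ⟨P, -, rfl⟩ ⟨Q, -, h⟩
  simp at h

theorem ncard_recDegree_eq_zero (n : ℕ) :
    {P : BinPath | P.length = n ∧ recDegree P = 0}.ncard = 1 := by
  rw [Set.ncard_eq_one]
  refine ⟨maxPath n, ?_⟩
  ext P
  simp only [Set.mem_ofPred_eq, Set.mem_singleton_iff, recDegree_eq_zero_iff]
  constructor
  · rintro ⟨rfl, h⟩
    exact h
  · rintro rfl
    simp [maxPath]

theorem choose_add_choose_half (k : ℕ) :
    (k + 1).choose ((k + 2) / 2) + (k + 1).choose ((k + 3) / 2) =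
      (k + 2).choose ((k + 3) / 2) := by
  have h1 : (k + 3) / 2 = (k + 1) / 2 + 1 := by omega
  have h2 : (k + 1).choose ((k + 2) / 2) = (k + 1).choose ((k + 1) / 2) :=
    Nat.choose_symm_of_eq_add (by omega)
  rw [h2, h1, ← Nat.choose_succ_succ]

theorem ncard_recDegree_le {n : ℕ}
    (h : ∀ k, 1 ≤ k → {P : BinPath | P.length = n ∧ recDegree P = k}.ncard =
      (min n k).choose ((k + 2) / 2)) :
    ∀ k ≤ n, {P : BinPath | P.length = n ∧ recDegree P ≤ k}.ncard =
      (k + 1).choose ((k + 2) / 2)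
  | 0, _ => by simpa using ncard_recDegree_eq_zero n
  | k + 1, hk => by
    have hs : {P : BinPath | P.length = n ∧ recDegree P ≤ k + 1} =
        {P : BinPath | P.length = n ∧ recDegree P ≤ k} ∪
          {P : BinPath | P.length = n ∧ recDegree P = k + 1} := by
      ext P
      simp only [Set.mem_ofPred_eq, Set.mem_union]
      omega
    rw [hs, Set.ncard_union_eq _ (finite_setOf_length_eq_and _ _)
      (finite_setOf_length_eq_and _ _), ncard_recDegree_le h k (by omega),
      h (k + 1) (by omega), min_eq_right hk]
    · exact choose_add_choose_half k
    · rw [Set.disjoint_left]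
      rintro P ⟨-, h1⟩ ⟨-, h2⟩
      omega

theorem ncard_recDegree_eq (n : ℕ) (hn : 0 < n) : ∀ k, 1 ≤ k →
    {P : BinPath | P.length = n ∧ recDegree P = k}.ncard =
      (min n k).choose ((k + 2) / 2) := by
  induction n, hn using Nat.le_induction with
  | base =>
    intro k hk
    rw [show Nat.succ 0 = 0 + 1 from rfl, ncard_length_succ]
    simp only [List.length_eq_zero_iff]
    rcases eq_or_ne k 1 with rfl | hk1
    · have h1 : {P : BinPath | P = [] ∧ recDegree (true :: P) = 1} = ∅ := by
        ext P
        simp +contextual [recDegree]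
      have h2 : {P : BinPath | P = [] ∧ recDegree (false :: P) = 1} = {[]} := by
        ext P
        simp +contextual [recDegree]
      rw [h1, h2]
      simp
    · have h1 : {P : BinPath | P = [] ∧ recDegree (true :: P) = k} = ∅ := by
        ext P
        simp only [Set.mem_ofPred_eq, Set.mem_empty_iff_false, iff_false]
        rintro ⟨rfl, h⟩
        simp [recDegree] at h
        omega
      have h2 : {P : BinPath | P = [] ∧ recDegree (false :: P) = k} = ∅ := by
        ext P
        simp only [Set.mem_ofPred_eq, Set.mem_empty_iff_false, iff_false]
        rintro ⟨rfl, h⟩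
        simp [recDegree] at h
        omega
      rw [h1, h2, Nat.choose_eq_zero_of_lt (by omega)]
      simp
  | succ n hn ih =>
    intro k hk
    have hfalse : {P : BinPath | P.length = n ∧ recDegree (false :: P) = k} =
        {P : BinPath | P.length = n ∧ max (n + 1) (recDegree P + 2) = k} := by
      ext P
      refine and_congr_right fun hP => ?_
      rw [recDegree_false_cons (by omega), hP]
    rw [ncard_length_succ, hfalse]
    simp only [recDegree_true_cons]
    rw [ih k hk]
    rcases lt_trichotomy k (n + 1) with hlt | rfl | hgt
    · have h : {P : BinPath | P.length = n ∧ max (n + 1) (recDegree P + 2) = k} = ∅ := by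
        ext P
        simp only [Set.mem_ofPred_eq, Set.mem_empty_iff_false, iff_false]
        omega
      rw [h, Set.ncard_empty, min_eq_right (by omega), min_eq_right (by omega), add_zero]
    · obtain ⟨m, rfl⟩ : ∃ m, n = m + 1 := ⟨n - 1, by omega⟩
      have h : {P : BinPath | P.length = m + 1 ∧
          max (m + 1 + 1) (recDegree P + 2) = m + 1 + 1} =
          {P : BinPath | P.length = m + 1 ∧ recDegree P ≤ m} := by
        ext P
        simp only [Set.mem_ofPred_eq]
        omega
      rw [h, ncard_recDegree_le ih m (by omega), min_eq_left (by omega), min_self,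
        show (m + 1 + 1 + 2) / 2 = (m + 2) / 2 + 1 by omega, add_comm,
        ← Nat.choose_succ_succ]
    · have h : {P : BinPath | P.length = n ∧ max (n + 1) (recDegree P + 2) = k} =
          {P : BinPath | P.length = n ∧ recDegree P = k - 2} := by
        ext P
        simp only [Set.mem_ofPred_eq]
        omega
      rw [h, ih (k - 2) (by omega), min_eq_left (by omega), min_eq_left (by omega),
        min_eq_left (by omega), show (k + 2) / 2 = (k - 2 + 2) / 2 + 1 by omega, add_comm,
        ← Nat.choose_succ_succ]

/-- For `n ≥ 1` and `1 ≤ k ≤ 2n − 1`, the number of binary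
paths of length `n` with degree `k` equals `C(min{n,k}, ⌊(k+2)/2⌋)`. -/
theorem statement7 (n k : ℕ) (hn : 0 < n) (hk1 : 1 ≤ k) (hk2 : k ≤ 2 * n - 1) :
    Set.ncard {P : BinPath | P.length = n ∧ degree P = k}
      = (min n k).choose ((k + 2) / 2) := by
  simp only [degree_eq_recDegree]
  exact ncard_recDegree_eq n hn k hk1
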